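/- There exists δ > 0 such that for every real v with 0 < |v| < δ, there is a unique quadruple (b0, b1, b2, b3) ∈ ℝ^4 satisfying simultaneously: N(v, b0, b1, b2, b3) = 0, (∂N/∂v)(v, b0, b1, b2, b3) = 0, (∂²N/∂v²)(v, b0, b1, b2, b3) = 0, and (∂³N/∂v³)(v, b0, b1, b2, b3) = 0, where the partial derivatives are taken in v with b0,…,b3 held fixed. (This quadruple gives the 8-step method with zero phase-lag and zero first, second and third derivatives of the phase-lag.) -/

import Mathlib

/-- Phase-lag numerator of the symmetric 8-step method. -/
noncomputable def N (v b0 b1 b2 b3 : ℝ) : ℝ :=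
  16 * Real.cos v ^ 4 + (8 * b3 * v ^ 2 - 16) * Real.cos v ^ 3
    + (4 * b2 * v ^ 2 - 8) * Real.cos v ^ 2
    + (10 + (2 * b1 - 6 * b3) * v ^ 2) * Real.cos v - 2
    + (b0 - 2 * b2) * v ^ 2

open Real in
theorem hasDerivAt_N (b0 b1 b2 b3 w : ℝ) :
    HasDerivAt (fun w => N w b0 b1 b2 b3)
      (-sin w * (64 * cos w ^ 3 - 48 * cos w ^ 2 - 16 * cos w + 10)
        + 2 * w * (8 * b3 * cos w ^ 3 + 4 * b2 * cos w ^ 2 + (2 * b1 - 6 * b3) * cos w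
          + (b0 - 2 * b2))
        - w ^ 2 * sin w * (24 * b3 * cos w ^ 2 + 8 * b2 * cos w + (2 * b1 - 6 * b3))) w := by
  have hc := hasDerivAt_cos w
  have hw := (hasDerivAt_id' w).fun_pow 2
  unfold N
  refine ((((((hc.fun_pow 4).const_mul 16).fun_add
    (((hw.const_mul (8 * b3)).sub_const 16).fun_mul (hc.fun_pow 3))).fun_add
    (((hw.const_mul (4 * b2)).sub_const 8).fun_mul (hc.fun_pow 2))).fun_add
    (((hw.const_mul (2 * b1 - 6 * b3)).const_add 10).fun_mul hc)).sub_const 2).fun_add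
    (hw.const_mul (b0 - 2 * b2)) |>.congr_deriv ?_
  push_cast
  ring

open Real in
theorem deriv_N (b0 b1 b2 b3 : ℝ) :
    deriv (fun w => N w b0 b1 b2 b3) = fun w =>
      -sin w * (64 * cos w ^ 3 - 48 * cos w ^ 2 - 16 * cos w + 10)
        + 2 * w * (8 * b3 * cos w ^ 3 + 4 * b2 * cos w ^ 2 + (2 * b1 - 6 * b3) * cos w
          + (b0 - 2 * b2))
        - w ^ 2 * sin w * (24 * b3 * cos w ^ 2 + 8 * b2 * cos w + (2 * b1 - 6 * b3)) :=
  funext fun w => (hasDerivAt_N b0 b1 b2 b3 w).deriv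

open Real in
theorem iteratedDeriv_two_N (b0 b1 b2 b3 : ℝ) :
    iteratedDeriv 2 (fun w => N w b0 b1 b2 b3) = fun w =>
      -cos w * (64 * cos w ^ 3 - 48 * cos w ^ 2 - 16 * cos w + 10)
        + sin w ^ 2 * (192 * cos w ^ 2 - 96 * cos w - 16)
        + 2 * (8 * b3 * cos w ^ 3 + 4 * b2 * cos w ^ 2 + (2 * b1 - 6 * b3) * cos w
          + (b0 - 2 * b2))
        - (4 * w * sin w + w ^ 2 * cos w)
          * (24 * b3 * cos w ^ 2 + 8 * b2 * cos w + (2 * b1 - 6 * b3))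
        + w ^ 2 * sin w ^ 2 * (48 * b3 * cos w + 8 * b2) := by
  rw [iteratedDeriv_succ, iteratedDeriv_one, deriv_N]
  funext w
  have hc := hasDerivAt_cos w
  have hs := hasDerivAt_sin w
  have hw := hasDerivAt_id' w
  have hα := ((((hc.fun_pow 3).const_mul 64).fun_sub ((hc.fun_pow 2).const_mul 48)).fun_sub
    (hc.const_mul 16)).add_const 10
  have hq := ((((hc.fun_pow 3).const_mul (8 * b3)).fun_add ((hc.fun_pow 2).const_mul (4 * b2))).fun_add
    (hc.const_mul (2 * b1 - 6 * b3))).add_const (b0 - 2 * b2)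
  have hq' := (((hc.fun_pow 2).const_mul (24 * b3)).fun_add (hc.const_mul (8 * b2))).add_const
    (2 * b1 - 6 * b3)
  refine HasDerivAt.deriv ?_
  convert ((hs.fun_neg.fun_mul hα).fun_add ((hw.const_mul 2).fun_mul hq)).fun_sub
    (((hw.fun_pow 2).fun_mul hs).fun_mul hq') using 1
  push_cast
  ring

open Real in
theorem iteratedDeriv_three_N (b0 b1 b2 b3 : ℝ) :
    iteratedDeriv 3 (fun w => N w b0 b1 b2 b3) = fun w =>
      sin w * (64 * cos w ^ 3 - 48 * cos w ^ 2 - 16 * cos w + 10)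
        + 3 * sin w * cos w * (192 * cos w ^ 2 - 96 * cos w - 16)
        - sin w ^ 3 * (384 * cos w - 96)
        + (w ^ 2 * sin w - 6 * sin w - 6 * w * cos w)
          * (24 * b3 * cos w ^ 2 + 8 * b2 * cos w + (2 * b1 - 6 * b3))
        + (6 * w * sin w ^ 2 + 3 * w ^ 2 * sin w * cos w) * (48 * b3 * cos w + 8 * b2)
        - w ^ 2 * sin w ^ 3 * (48 * b3) := by
  rw [iteratedDeriv_succ, iteratedDeriv_two_N]
  funext w
  have hc := hasDerivAt_cos w
  have hs := hasDerivAt_sin w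
  have hw := hasDerivAt_id' w
  have hα := ((((hc.fun_pow 3).const_mul 64).fun_sub ((hc.fun_pow 2).const_mul 48)).fun_sub
    (hc.const_mul 16)).add_const 10
  have hα' := (((hc.fun_pow 2).const_mul 192).fun_sub (hc.const_mul 96)).sub_const 16
  have hq := ((((hc.fun_pow 3).const_mul (8 * b3)).fun_add ((hc.fun_pow 2).const_mul (4 * b2))).fun_add
    (hc.const_mul (2 * b1 - 6 * b3))).add_const (b0 - 2 * b2)
  have hq' := (((hc.fun_pow 2).const_mul (24 * b3)).fun_add (hc.const_mul (8 * b2))).add_const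
    (2 * b1 - 6 * b3)
  have hq'' := (hc.const_mul (48 * b3)).add_const (8 * b2)
  refine HasDerivAt.deriv ?_
  convert ((((hc.fun_neg.fun_mul hα).fun_add ((hs.fun_pow 2).fun_mul hα')).fun_add (hq.const_mul 2)).fun_sub
    ((((hw.const_mul 4).fun_mul hs).fun_add ((hw.fun_pow 2).fun_mul hc)).fun_mul hq')).fun_add
    (((hw.fun_pow 2).fun_mul (hs.fun_pow 2)).fun_mul hq'') using 1
  push_cast
  ring

/-- A lower triangular `4 × 4` system in the Taylor coefficients at `c` of the cubic
`8 b₃ x³ + 4 b₂ x² + (2 b₁ - 6 b₃) x + (b₀ - 2 b₂)` determines `b` uniquely. -/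
theorem existsUnique_of_triangular {c m00 m11 m22 m33 : ℝ} (m10 m20 m21 m30 m31 m32 : ℝ)
    (e0 e1 e2 e3 : ℝ) (h0 : m00 ≠ 0) (h1 : m11 ≠ 0) (h2 : m22 ≠ 0) (h3 : m33 ≠ 0) :
    ∃! b : ℝ × ℝ × ℝ × ℝ, ∃ q0 q1 q2 q3 : ℝ,
      (q0 = 8 * b.2.2.2 * c ^ 3 + 4 * b.2.2.1 * c ^ 2 + (2 * b.2.1 - 6 * b.2.2.2) * c
          + (b.1 - 2 * b.2.2.1) ∧
        q1 = 24 * b.2.2.2 * c ^ 2 + 8 * b.2.2.1 * c + (2 * b.2.1 - 6 * b.2.2.2) ∧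
        q2 = 48 * b.2.2.2 * c + 8 * b.2.2.1 ∧ q3 = 48 * b.2.2.2) ∧
      e0 + m00 * q0 = 0 ∧ e1 + m10 * q0 + m11 * q1 = 0 ∧
      e2 + m20 * q0 + m21 * q1 + m22 * q2 = 0 ∧
      e3 + m30 * q0 + m31 * q1 + m32 * q2 + m33 * q3 = 0 := by
  obtain ⟨q0, hq0⟩ : ∃ q, e0 + m00 * q = 0 := ⟨-e0 / m00, by field_simp; ring⟩
  obtain ⟨q1, hq1⟩ : ∃ q, e1 + m10 * q0 + m11 * q = 0 :=
    ⟨-(e1 + m10 * q0) / m11, by field_simp; ring⟩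
  obtain ⟨q2, hq2⟩ : ∃ q, e2 + m20 * q0 + m21 * q1 + m22 * q = 0 :=
    ⟨-(e2 + m20 * q0 + m21 * q1) / m22, by field_simp; ring⟩
  obtain ⟨q3, hq3⟩ : ∃ q, e3 + m30 * q0 + m31 * q1 + m32 * q2 + m33 * q = 0 :=
    ⟨-(e3 + m30 * q0 + m31 * q1 + m32 * q2) / m33, by field_simp; ring⟩
  refine ⟨(q0 - c * q1 + c ^ 2 / 2 * q2 - c ^ 3 / 6 * q3 + (q2 - c * q3) / 4,
    (q1 - c * q2 + c ^ 2 / 2 * q3) / 2 + q3 / 16, (q2 - c * q3) / 8, q3 / 48),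
    ⟨q0, q1, q2, q3, ⟨by ring, by ring, by ring, by ring⟩, hq0, hq1, hq2, hq3⟩, ?_⟩
  rintro ⟨b0, b1, b2, b3⟩ ⟨p0, p1, p2, p3, ⟨hb0, hb1, hb2, hb3⟩, hp0, hp1, hp2, hp3⟩
  obtain rfl : p0 = q0 := mul_left_cancel₀ h0 (by linarith)
  obtain rfl : p1 = q1 := mul_left_cancel₀ h1 (by linarith)
  obtain rfl : p2 = q2 := mul_left_cancel₀ h2 (by linarith)
  obtain rfl : p3 = q3 := mul_left_cancel₀ h3 (by linarith)
  dsimp only at hb0 hb1 hb2 hb3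
  subst hb0 hb1 hb2 hb3
  ext <;> dsimp only <;> ring

/-- For all sufficiently small nonzero `v` there is a unique coefficient
quadruple with zero phase-lag and zero first, second and third derivatives
of the phase-lag. -/
theorem exists_unique_coeffs_zero_PL_PL'_PL''_PL''' :
    ∃ δ : ℝ, 0 < δ ∧ ∀ v : ℝ, 0 < |v| → |v| < δ →
      ∃! b : ℝ × ℝ × ℝ × ℝ,
        N v b.1 b.2.1 b.2.2.1 b.2.2.2 = 0 ∧
        deriv (fun w => N w b.1 b.2.1 b.2.2.1 b.2.2.2) v = 0 ∧
        iteratedDeriv 2 (fun w => N w b.1 b.2.1 b.2.2.1 b.2.2.2) v = 0 ∧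
        iteratedDeriv 3 (fun w => N w b.1 b.2.1 b.2.2.1 b.2.2.2) v = 0 := by
  refine ⟨Real.pi, Real.pi_pos, fun v hv hvπ => ?_⟩
  have hv0 : v ≠ 0 := abs_pos.mp hv
  obtain ⟨hlo, hhi⟩ := abs_lt.mp hvπ
  have hs : Real.sin v ≠ 0 := fun h => hv0 ((Real.sin_eq_zero_iff_of_lt_of_lt hlo hhi).mp h)
  simp only [deriv_N, iteratedDeriv_two_N, iteratedDeriv_three_N]
  set s := Real.sin v
  set c := Real.cos v with hc
  refine (existsUnique_congr fun b => ?_).mp <| existsUnique_of_triangular (c := c)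
    (m00 := v ^ 2) (m11 := -v ^ 2 * s) (m22 := v ^ 2 * s ^ 2) (m33 := -v ^ 2 * s ^ 3)
    (2 * v) 2 (-(4 * v * s + v ^ 2 * c)) 0 (v ^ 2 * s - 6 * s - 6 * v * c)
    (6 * v * s ^ 2 + 3 * v ^ 2 * s * c)
    (16 * c ^ 4 - 16 * c ^ 3 - 8 * c ^ 2 + 10 * c - 2)
    (-s * (64 * c ^ 3 - 48 * c ^ 2 - 16 * c + 10))
    (-c * (64 * c ^ 3 - 48 * c ^ 2 - 16 * c + 10) + s ^ 2 * (192 * c ^ 2 - 96 * c - 16))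
    (s * (64 * c ^ 3 - 48 * c ^ 2 - 16 * c + 10) + 3 * s * c * (192 * c ^ 2 - 96 * c - 16)
      - s ^ 3 * (384 * c - 96))
    (by simp [hv0]) (by simp [hv0, hs]) (by simp [hv0, hs]) (by simp [hv0, hs])
  rw [N, ← hc]
  constructor
  · rintro ⟨q0, q1, q2, q3, ⟨rfl, rfl, rfl, rfl⟩, h0, h1, h2, h3⟩
    exact ⟨by linear_combination h0, by linear_combination h1, by linear_combination h2,
      by linear_combination h3⟩
  · rintro ⟨h0, h1, h2, h3⟩
    exact ⟨_, _, _, _, ⟨rfl, rfl, rfl, rfl⟩, by linear_combination h0,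
      by linear_combination h1, by linear_combination h2, by linear_combination h3⟩
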